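/- Let A ∈ ℝ^{n×n} and B = [I_m; 0] ∈ ℝ^{n×m}. Partition the rows [1,n] into the leader set L = [1,m] and consecutive follower blocks F₁,…,F_K of sizes m₁,…,m_K with m + m₁ + ⋯ + m_K = n, each m_k ≥ 1. Assume that for each k ∈ [1,K] the rows of A^j B indexed by F_k are zero for every j < k, and that Φ_k ∈ ℝ^{m_k×m}, the submatrix of A^k B formed by the rows indexed by F_k, has no zero rows. For each k define J_k := {j ∈ [1,m] : Φ_k e_j is unisigned} and H_k := ⋃_{j∈J_k} ZP(Φ_k e_j). Suppose that for every k ∈ [1,K] and every h ∈ [1,m_k]∖H_k there exists i ∈ [1,m]∖J_k such that (i) [Φ_k]_{hi} ≠ 0, and (ii) for every ℓ ∈ [1,m_k]∖H_k, [Φ_k]_{ℓi} ≠ 0 implies sign([Φ_k]_{ℓi}) = sign([Φ_k]_{hi}). Then the pair (A,B) is herdable. -/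

import Mathlib

open Matrix

/-- A nonzero real vector is unisigned if all its nonzero entries have the same sign. -/
def Unisigned {ι : Type*} (v : ι → ℝ) : Prop :=
  v ≠ 0 ∧ ((∀ i, 0 ≤ v i) ∨ (∀ i, v i ≤ 0))

/-- The controllability matrix `[B | AB | A²B | ... | A^{n-1}B]` of the pair `(A, B)`,
where the state is indexed by a finite type `I` of cardinality `n`. -/
def ctrbMat {I : Type*} [Fintype I] [DecidableEq I] {m : ℕ}
    (A : Matrix I I ℝ) (B : Matrix I (Fin m) ℝ) :
    Matrix I (Fin (Fintype.card I) × Fin m) ℝ :=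
  Matrix.of fun i p => (A ^ (p.1 : ℕ) * B) i p.2

/-- The state indices: the `m` leaders followed by the follower blocks `F₁, …, F_K`
of sizes `ms 0, …, ms (K-1)`, so that `n = m + m₁ + ⋯ + m_K`. -/
abbrev LFIdx (m K : ℕ) (ms : Fin K → ℕ) := Fin m ⊕ (Σ k : Fin K, Fin (ms k))

/-- Adding a large multiple of `f` to `g` makes `g` positive wherever `f` is. -/
lemma exists_nonneg_forall_pos_add_mul {ι : Type*} [Finite ι] (f g : ι → ℝ) :
    ∃ N : ℝ, 0 ≤ N ∧ ∀ i, 0 < f i → 0 < g i + N * f i := by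
  have key : ∀ i, ∀ᶠ N : ℝ in Filter.atTop, 0 < f i → 0 < g i + N * f i := by
    intro i
    filter_upwards [Filter.eventually_gt_atTop (-g i / f i)] with N hN hf
    rw [div_lt_iff₀ hf] at hN
    linarith
  obtain ⟨N, hN⟩ := ((Filter.eventually_ge_atTop 0).and (Filter.eventually_all.2 key)).exists
  exact ⟨N, hN⟩

/-- A subspace that contains, for each level `t`, a vector positive on the indices of level `t`
and vanishing on the indices of higher level, contains a positive vector. -/
lemma exists_pos_mem_of_levels {I : Type*} [Finite I] (S : Submodule ℝ (I → ℝ)) (level : I → ℕ)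
    (hS : ∀ t, ∃ y ∈ S, (∀ i, level i = t → 0 < y i) ∧ ∀ i, t < level i → y i = 0) :
    ∃ x ∈ S, ∀ i, 0 < x i := by
  obtain ⟨n, hn⟩ := (Set.finite_range level).bddAbove
  have key : ∃ x ∈ S, ∀ i, 0 ≤ level i → 0 < x i := by
    refine Nat.decreasingInduction (n := n + 1)
      (motive := fun t _ => ∃ x ∈ S, ∀ i, t ≤ level i → 0 < x i) ?_ ?_ (Nat.zero_le _)
    · rintro t - ⟨x, hxS, hx⟩
      obtain ⟨y, hyS, hy, hy0⟩ := hS t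
      obtain ⟨N, -, hN⟩ := exists_nonneg_forall_pos_add_mul y x
      refine ⟨x + N • y, S.add_mem hxS (S.smul_mem N hyS), fun i hi => ?_⟩
      rcases hi.eq_or_lt with h | h
      · exact hN i (hy i h.symm)
      · simpa [hy0 i h] using hx i h
    · refine ⟨0, S.zero_mem, fun i hi => ?_⟩
      have := hn (Set.mem_range_self i)
      omega
  obtain ⟨x, hxS, hx⟩ := key
  exact ⟨x, hxS, fun i => hx i (Nat.zero_le _)⟩

lemma Unisigned.exists_mul_nonneg {ι : Type*} {v : ι → ℝ} (hv : Unisigned v) :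
    ∃ s : ℝ, (∀ i, 0 ≤ v i * s) ∧ ∀ i, v i ≠ 0 → 0 < v i * s := by
  rcases hv.2 with h | h
  · exact ⟨1, fun i => by simpa using h i, fun i hi => by simpa using (h i).lt_of_ne' hi⟩
  · exact ⟨-1, fun i => by simpa using h i, fun i hi => by simpa using (h i).lt_of_ne hi⟩

lemma Real.mul_sign_pos {x : ℝ} (hx : x ≠ 0) : 0 < x * Real.sign x := by
  rcases hx.lt_or_gt with h | h
  · simpa [Real.sign_of_neg h] using h
  · simpa [Real.sign_of_pos h] using h

/-- If every row in `P` has a column of `M` in which it is nonzero, and which, after a change of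
sign, is nonnegative on the rows in `Q`, then some combination of the columns of `M` is nonnegative
on `Q` and positive on `P ∩ Q`. -/
lemma exists_mulVec_nonneg_pos {ι κ : Type*} [Fintype ι] [Fintype κ] [DecidableEq κ]
    (M : Matrix ι κ ℝ) (P Q : Set ι)
    (h : ∀ i ∈ P, ∃ c s, 0 < M i c * s ∧ ∀ l ∈ Q, 0 ≤ M l c * s) :
    ∃ u : κ → ℝ, (∀ l ∈ Q, 0 ≤ (M *ᵥ u) l) ∧ ∀ l ∈ P ∩ Q, 0 < (M *ᵥ u) l := by
  classical
  choose c s hpos hnonneg using fun i : P => h i i.2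
  have hsum : ∀ l, (M *ᵥ ∑ i, Pi.single (c i) (s i)) l = ∑ i, M l (c i) * s i := by
    intro l
    simp [Matrix.mulVec_sum, Matrix.mulVec_single, mul_comm]
  refine ⟨∑ i, Pi.single (c i) (s i), fun l hl => ?_, fun l hl => ?_⟩
  · rw [hsum]
    exact Finset.sum_nonneg fun i _ => hnonneg i l hl
  · rw [hsum]
    exact Finset.sum_pos' (fun i _ => hnonneg i l hl.2) ⟨⟨l, hl.1⟩, Finset.mem_univ _, hpos ⟨l, hl.1⟩⟩

/-- The sign condition on a single block of rows yields a positive vector in its column space. -/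
lemma exists_mulVec_pos_of_unisigned {ι κ : Type*} [Fintype ι] [Fintype κ] [DecidableEq κ]
    (M : Matrix ι κ ℝ) (H : Set ι)
    (hH : ∀ i ∈ H, ∃ c, Unisigned (fun l => M l c) ∧ M i c ≠ 0)
    (hcond : ∀ h ∉ H, ∃ c, M h c ≠ 0 ∧
      ∀ l ∉ H, M l c ≠ 0 → Real.sign (M l c) = Real.sign (M h c)) :
    ∃ u : κ → ℝ, ∀ i, 0 < (M *ᵥ u) i := by
  obtain ⟨v, hv, hvH⟩ := exists_mulVec_nonneg_pos M H Set.univ fun i hi => by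
    obtain ⟨c, hc, hic⟩ := hH i hi
    obtain ⟨s, hs, hs'⟩ := hc.exists_mul_nonneg
    exact ⟨c, s, hs' i hic, fun l _ => hs l⟩
  obtain ⟨w, -, hw⟩ := exists_mulVec_nonneg_pos M Hᶜ Hᶜ fun h hh => by
    obtain ⟨c, hc, hsign⟩ := hcond h hh
    refine ⟨c, Real.sign (M h c), Real.mul_sign_pos hc, fun l hl => ?_⟩
    by_cases h0 : M l c = 0
    · simp [h0]
    · rw [← hsign l hl h0]
      exact (Real.mul_sign_pos h0).le
  obtain ⟨N, hN0, hN⟩ := exists_nonneg_forall_pos_add_mul (M *ᵥ v) (M *ᵥ w)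
  refine ⟨w + N • v, fun i => ?_⟩
  rw [Matrix.mulVec_add, Matrix.mulVec_smul, Pi.add_apply, Pi.smul_apply, smul_eq_mul]
  by_cases hi : i ∈ H
  · exact hN i (hvH i ⟨hi, trivial⟩)
  · exact add_pos_of_pos_of_nonneg (hw i ⟨hi, hi⟩) (mul_nonneg hN0 (hv i trivial))

lemma pow_mul_mulVec_mem_range_ctrbMat {I : Type*} [Fintype I] [DecidableEq I] {m : ℕ}
    (A : Matrix I I ℝ) (B : Matrix I (Fin m) ℝ) {t : ℕ} (ht : t < Fintype.card I)
    (v : Fin m → ℝ) :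
    (A ^ t * B) *ᵥ v ∈ LinearMap.range (ctrbMat A B).mulVecLin := by
  refine ⟨fun p => if p.1 = ⟨t, ht⟩ then v p.2 else 0, ?_⟩
  ext i
  simp only [Matrix.mulVecLin_apply, Matrix.mulVec, dotProduct, ctrbMat, Matrix.of_apply]
  rw [Fintype.sum_prod_type, Finset.sum_eq_single ⟨t, ht⟩]
  · simp
  · intro b _ hb
    simp [hb]
  · simp

lemma le_card_LFIdx {m K : ℕ} {ms : Fin K → ℕ} (hms : ∀ k, 0 < ms k) :
    m + K ≤ Fintype.card (LFIdx m K ms) := by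
  have h : ∑ _k : Fin K, 1 ≤ ∑ k, ms k := Finset.sum_le_sum fun _ _ => hms _
  simpa using h

theorem stmt4 {m K : ℕ} (ms : Fin K → ℕ) (hms : ∀ k, 0 < ms k)
    (A : Matrix (LFIdx m K ms) (LFIdx m K ms) ℝ)
    (B : Matrix (LFIdx m K ms) (Fin m) ℝ)
    -- B = [I_m ; 0]
    (hB : B = Matrix.of fun i j => if i = Sum.inl j then 1 else 0)
    -- the rows of A^j B indexed by the block F_{k+1} are zero for every j < k+1
    (hzero : ∀ (k : Fin K) (j : ℕ), j < (k : ℕ) + 1 →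
      ∀ (i : Fin (ms k)) (c : Fin m), (A ^ j * B) (Sum.inr ⟨k, i⟩) c = 0)
    -- Φ_{k+1} : the rows of A^{k+1} B indexed by the block F_{k+1}
    (Φ : ∀ k : Fin K, Matrix (Fin (ms k)) (Fin m) ℝ)
    (hΦ : ∀ (k : Fin K) (i : Fin (ms k)) (c : Fin m),
      Φ k i c = (A ^ ((k : ℕ) + 1) * B) (Sum.inr ⟨k, i⟩) c)
    -- each Φ_k has no zero rows
    (hrows : ∀ (k : Fin K) (i : Fin (ms k)), ∃ c, Φ k i c ≠ 0)
    -- J_k : set of indices of unisigned columns of Φ_k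
    (J : ∀ k : Fin K, Set (Fin m))
    (hJ : ∀ k, J k = {c | Unisigned (fun i => Φ k i c)})
    -- H_k : union of the nonzero patterns of the unisigned columns of Φ_k
    (H : ∀ k : Fin K, Set (Fin (ms k)))
    (hH : ∀ k, H k = {i | ∃ c ∈ J k, Φ k i c ≠ 0})
    -- for every h ∉ H_k there is a column i ∉ J_k of Φ_k whose h-th entry is nonzero and
    -- all of whose nonzero entries at indices outside H_k have the same sign as its h-th entry
    (hcond : ∀ (k : Fin K) (h : Fin (ms k)), h ∉ H k →
      ∃ i : Fin m, i ∉ J k ∧ Φ k h i ≠ 0 ∧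
        ∀ l : Fin (ms k), l ∉ H k → Φ k l i ≠ 0 →
          Real.sign (Φ k l i) = Real.sign (Φ k h i)) :
    -- the pair (A,B) is herdable
    ∃ u : Fin (Fintype.card (LFIdx m K ms)) × Fin m → ℝ,
      ∀ i, 0 < (ctrbMat A B).mulVec u i := by
  rcases Nat.eq_zero_or_pos m with rfl | hm
  · refine ⟨0, fun i => ?_⟩
    rcases i with i | ⟨k, i⟩
    · exact i.elim0
    · exact (hrows k i).choose.elim0
  have hcard := le_card_LFIdx (m := m) hms
  have hblock : ∀ k, ∃ u, ∀ i, 0 < (Φ k *ᵥ u) i := fun k => by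
    refine exists_mulVec_pos_of_unisigned (Φ k) (H k) (fun i hi => ?_) fun h hh => ?_
    · simpa [hH, hJ] using hi
    · obtain ⟨c, -, hc⟩ := hcond k h hh
      exact ⟨c, hc⟩
  have hvanish : ∀ (k : Fin K) (j : ℕ), j < (k : ℕ) + 1 → ∀ (i : Fin (ms k)) (v : Fin m → ℝ),
      ((A ^ j * B) *ᵥ v) (Sum.inr ⟨k, i⟩) = 0 := fun k j hj i v => by
    simp [Matrix.mulVec, dotProduct, hzero k j hj i]
  obtain ⟨x, ⟨u, rfl⟩, hu⟩ := exists_pos_mem_of_levels (LinearMap.range (ctrbMat A B).mulVecLin)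
    (Sum.elim (fun _ => 0) fun p => (p.1 : ℕ) + 1) fun t => by
      rcases t with _ | t
      · refine ⟨_, pow_mul_mulVec_mem_range_ctrbMat A B (t := 0) (by omega) (fun _ => 1), ?_, ?_⟩
        · rintro (i | ⟨k, i⟩) hi
          · simp [hB, Matrix.mulVec, dotProduct]
          · simp at hi
        · rintro (i | ⟨k, i⟩) hi
          · simp at hi
          · exact hvanish k 0 hi i _
      · by_cases ht : t < K
        · obtain ⟨v, hv⟩ := hblock ⟨t, ht⟩
          refine ⟨_, pow_mul_mulVec_mem_range_ctrbMat A B (t := t + 1) (by omega) v, ?_, ?_⟩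
          · rintro (i | ⟨k, i⟩) hi
            · simp at hi
            · obtain rfl : k = ⟨t, ht⟩ := Fin.ext (by simpa using hi)
              simpa [Matrix.mulVec, dotProduct, hΦ] using hv i
          · rintro (i | ⟨k, i⟩) hi
            · simp at hi
            · exact hvanish k _ hi i v
        · refine ⟨0, Submodule.zero_mem _, ?_, fun _ _ => rfl⟩
          rintro (i | ⟨k, i⟩) hi
          · simp at hi
          · simp at hi
            omega
  exact ⟨u, hu⟩
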